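/- arXiv:2011.03087 — 2 statements merged into one kernel-verified Lean document; each statement's English description precedes it below -/
import Mathlib

section
/- Let G be a finite simple graph and M a perfect matching of G. Then f_f(G, 𝟙_M) ≥ f(G, M), where 𝟙_M is the characteristic function of M. Furthermore, if G is bipartite, then f_f(G, 𝟙_M) = f(G, M). -/
open Finset

variable {V : Type} [Fintype V] [DecidableEq V]

/-- The sum of `γ` over the edges of `G` incident with the vertex `v`.
(Functions on `E(G)` are encoded as functions on `Sym2 V` vanishing off the edge set.) -/
def vertexSum (G : SimpleGraph V) [DecidableRel G.Adj] (γ : Sym2 V → ℝ) (v : V) : ℝ :=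
  ∑ e ∈ G.edgeFinset, if v ∈ e then γ e else 0

/-- `γ` is a fractional perfect matching of `G`. -/
def IsFPM (G : SimpleGraph V) [DecidableRel G.Adj] (γ : Sym2 V → ℝ) : Prop :=
  (∀ e, 0 ≤ γ e) ∧ (∀ e ∉ G.edgeSet, γ e = 0) ∧ ∀ v, vertexSum G γ v = 1

/-- `α ↑ γ` : `α` is a (nonnegative) forcing function for the fractional perfect matching
`γ`, i.e. `α ⪯ γ` and `γ` is the unique fractional perfect matching `γ'` with `α ⪯ γ'`. -/
def IsForcing (G : SimpleGraph V) [DecidableRel G.Adj] (α γ : Sym2 V → ℝ) : Prop :=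
  (∀ e, 0 ≤ α e) ∧ (∀ e ∉ G.edgeSet, α e = 0) ∧ α ≤ γ ∧
    ∀ γ', IsFPM G γ' → α ≤ γ' → γ' = γ

/-- `|α|`, the sum of the values of `α` over all edges of `G`. -/
def eSum (G : SimpleGraph V) [DecidableRel G.Adj] (α : Sym2 V → ℝ) : ℝ :=
  ∑ e ∈ G.edgeFinset, α e

/-- The fractional forcing number `f_f(G,γ) = min {|α| : α ↑ γ}`. -/
noncomputable def ffN (G : SimpleGraph V) [DecidableRel G.Adj] (γ : Sym2 V → ℝ) : ℝ :=
  sInf {x : ℝ | ∃ α, IsForcing G α γ ∧ x = eSum G α}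

/-- `M` is a perfect matching of `G`: a set of pairwise disjoint edges covering every
vertex, i.e. every vertex lies in exactly one edge of `M`. -/
def IsPM (G : SimpleGraph V) (M : Finset (Sym2 V)) : Prop :=
  ↑M ⊆ G.edgeSet ∧ ∀ v : V, ∃! e, e ∈ M ∧ v ∈ e

/-- The characteristic function `𝟙_M` of a set of edges `M`. -/
def charF (M : Finset (Sym2 V)) : Sym2 V → ℝ := fun e => if e ∈ M then 1 else 0

/-- `S` is a forcing set for the perfect matching `M`: `S ⊆ M` and `M` is the unique
perfect matching of `G` containing `S`. -/
def IsForcingSet (G : SimpleGraph V) (S : Set (Sym2 V)) (M : Finset (Sym2 V)) : Prop :=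
  S ⊆ ↑M ∧ ∀ M', IsPM G M' → S ⊆ ↑M' → M' = M

/-- The forcing number `f(G,M)`: the minimum size of a forcing set for `M`. -/
noncomputable def fN (G : SimpleGraph V) (M : Finset (Sym2 V)) : ℕ :=
  sInf {n : ℕ | ∃ S : Finset (Sym2 V), IsForcingSet G ↑S M ∧ S.card = n}

/-- The characteristic function of a perfect matching is a fractional perfect matching. -/
lemma IsPM.isFPM_charF {G : SimpleGraph V} [DecidableRel G.Adj] {M : Finset (Sym2 V)}
    (hM : IsPM G M) : IsFPM G (charF M) := by
  refine ⟨fun e => ?_, fun e he => ?_, fun v => ?_⟩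
  · unfold charF
    split_ifs <;> norm_num
  · exact if_neg fun h => he (hM.1 h)
  · obtain ⟨e, ⟨heM, hve⟩, huniq⟩ := hM.2 v
    unfold vertexSum charF
    rw [Finset.sum_eq_single e]
    · simp [heM, hve]
    · intro b _ hbe
      split_ifs with h₁ h₂
      · exact absurd (huniq b ⟨h₂, h₁⟩) hbe
      · rfl
      · rfl
    · intro h
      exact absurd (SimpleGraph.mem_edgeFinset.2 (hM.1 heM)) h

lemma charF_injective {W : Type} [DecidableEq W] : Function.Injective (charF (V := W)) := by
  intro M N h
  ext e
  have := congrFun h e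
  unfold charF at this
  split_ifs at this <;> simp_all

lemma charF_mono {W : Type} [DecidableEq W] {S M : Finset (Sym2 W)} (h : S ⊆ M) : charF S ≤ charF M := by
  intro e
  unfold charF
  split_ifs with h₁ h₂
  · rfl
  · exact absurd (h h₁) h₂
  · norm_num
  · rfl

lemma vertexSum_eq_sum {G : SimpleGraph V} [DecidableRel G.Adj] {γ : Sym2 V → ℝ}
    (hγ : ∀ e ∉ G.edgeSet, γ e = 0) (v : V) : vertexSum G γ v = ∑ w, γ s(v, w) := by
  unfold vertexSum
  rw [Finset.sum_subset (Finset.subset_univ _), ← Finset.sum_filter]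
  · symm
    refine Finset.sum_bij (fun w _ => s(v, w)) ?_ ?_ ?_ ?_
    · simp
    · intro a _ b _ h
      exact Sym2.congr_right.1 h
    · intro e he
      obtain ⟨w, rfl⟩ := (Finset.mem_filter.1 he).2
      exact ⟨w, Finset.mem_univ _, rfl⟩
    · intros
      rfl
  · intro e _ he
    rw [hγ e (by simpa using he), ite_self]

lemma eSum_charF {G : SimpleGraph V} [DecidableRel G.Adj] {S : Finset (Sym2 V)}
    (hS : ↑S ⊆ G.edgeSet) : eSum G (charF S) = S.card := by
  have : G.edgeFinset ∩ S = S :=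
    Finset.inter_eq_right.2 fun e he => SimpleGraph.mem_edgeFinset.2 (hS he)
  unfold eSum charF
  rw [Finset.sum_ite_mem, this]
  simp

/-- The segment from `γ` to `γ'` consists of fractional perfect matchings. -/
lemma IsFPM.segment {G : SimpleGraph V} [DecidableRel G.Adj] {γ γ' : Sym2 V → ℝ}
    (h : IsFPM G γ) (h' : IsFPM G γ') {t : ℝ} (ht₀ : 0 ≤ t) (ht₁ : t ≤ 1) :
    IsFPM G fun e => (1 - t) * γ e + t * γ' e := by
  have hoff : ∀ e ∉ G.edgeSet, (1 - t) * γ e + t * γ' e = 0 := fun e he => by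
    rw [h.2.1 e he, h'.2.1 e he]
    ring
  refine ⟨fun e => ?_, hoff, fun v => ?_⟩
  · have := h.1 e
    have := h'.1 e
    have : 0 ≤ 1 - t := by linarith
    positivity
  · have h₁ := h.2.2 v
    have h₂ := h'.2.2 v
    rw [vertexSum_eq_sum h.2.1] at h₁
    rw [vertexSum_eq_sum h'.2.1] at h₂
    rw [vertexSum_eq_sum hoff, Finset.sum_add_distrib, ← Finset.mul_sum, ← Finset.mul_sum, h₁, h₂]
    ring

/-- The edges where a forcing function for `𝟙_M` takes the value `1` form a forcing set. -/
lemma IsForcing.isForcingSet {G : SimpleGraph V} [DecidableRel G.Adj] {M : Finset (Sym2 V)}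
    (hM : IsPM G M) {α : Sym2 V → ℝ} (hα : IsForcing G α (charF M)) :
    IsForcingSet G ↑(M.filter fun e => α e = 1) M := by
  obtain ⟨-, -, hle, huniq⟩ := hα
  refine ⟨Finset.coe_subset.2 (Finset.filter_subset _ _), fun M' hM' hS => ?_⟩
  obtain ⟨t, ht₀, ht₁, ht⟩ : ∃ t : ℝ, 0 < t ∧ t ≤ 1 ∧ ∀ e ∈ M, α e ≠ 1 → t ≤ 1 - α e := by
    rcases (M.filter fun e => α e ≠ 1).eq_empty_or_nonempty with h | h
    · refine ⟨1, one_pos, le_rfl, fun e he hne => ?_⟩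
      exact absurd (Finset.mem_filter.2 ⟨he, hne⟩) (h ▸ Finset.notMem_empty e)
    · obtain ⟨f, hf, hmin⟩ := Finset.exists_min_image _ (fun e => 1 - α e) h
      obtain ⟨hfM, hf₁⟩ := Finset.mem_filter.1 hf
      have hlt : α f < 1 := by
        have := hle f
        rw [charF, if_pos hfM] at this
        exact lt_of_le_of_ne this hf₁
      refine ⟨min 1 (1 - α f), by simp [hlt], min_le_left _ _, fun e he hne => ?_⟩
      exact (min_le_right _ _).trans (hmin e (Finset.mem_filter.2 ⟨he, hne⟩))
  have hseg := huniq _ (hM.isFPM_charF.segment hM'.isFPM_charF ht₀.le ht₁) fun e => by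
    have h₁ := hle e
    have h₂ := hM'.isFPM_charF.1 e
    by_cases heM : e ∈ M
    · rw [charF, if_pos heM] at h₁
      simp only [charF, if_pos heM] at h₂ ⊢
      by_cases he : α e = 1
      · rw [if_pos (Finset.mem_coe.1 (hS (Finset.mem_coe.2 (Finset.mem_filter.2 ⟨heM, he⟩))))]
        linarith
      · have := ht e heM he
        nlinarith
    · rw [charF, if_neg heM] at h₁
      simp only [charF, if_neg heM] at h₂ ⊢
      nlinarith
  refine charF_injective (funext fun e => ?_)
  have := congrFun hseg e
  have : t * (charF M' e - charF M e) = 0 := by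
    linarith
  rcases mul_eq_zero.1 this with h | h <;> linarith

lemma fN_le_eSum {G : SimpleGraph V} [DecidableRel G.Adj] {M : Finset (Sym2 V)}
    (hM : IsPM G M) {α : Sym2 V → ℝ} (hα : IsForcing G α (charF M)) :
    (fN G M : ℝ) ≤ eSum G α := by
  have h₁ : fN G M ≤ (M.filter fun e => α e = 1).card :=
    Nat.sInf_le ⟨_, hα.isForcingSet hM, rfl⟩
  have hsub : M.filter (fun e => α e = 1) ⊆ G.edgeFinset := fun e he =>
    SimpleGraph.mem_edgeFinset.2 (hM.1 (Finset.mem_filter.1 he).1)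
  calc (fN G M : ℝ) ≤ (M.filter fun e => α e = 1).card := by exact_mod_cast h₁
    _ = ∑ e ∈ M.filter fun e => α e = 1, α e := by
      rw [Finset.sum_congr rfl fun e he => (Finset.mem_filter.1 he).2]
      simp
    _ ≤ eSum G α := Finset.sum_le_sum_of_subset_of_nonneg hsub fun e _ _ => hα.1 e

lemma IsPM.isForcing_charF {G : SimpleGraph V} [DecidableRel G.Adj] {M : Finset (Sym2 V)}
    (hM : IsPM G M) : IsForcing G (charF M) (charF M) := by
  have h := hM.isFPM_charF
  refine ⟨h.1, h.2.1, le_rfl, fun γ hγ hle => (funext fun e => ?_)⟩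
  by_cases he : e ∈ G.edgeSet
  · induction e with | _ u v
    have h₁ := h.2.2 u
    rw [vertexSum_eq_sum h.2.1, ← hγ.2.2 u, vertexSum_eq_sum hγ.2.1] at h₁
    exact ((Finset.sum_eq_sum_iff_of_le fun w _ => hle s(u, w)).1 h₁ v (Finset.mem_univ v)).symm
  · rw [h.2.1 e he, hγ.2.1 e he]

/-- A perfect matching is given by an involution sending each vertex to its partner. -/
lemma IsPM.exists_partner {W : Type} {G : SimpleGraph W} {M : Finset (Sym2 W)}
    (hM : IsPM G M) :
    ∃ m : Equiv.Perm W, (∀ v, m (m v) = v) ∧ ∀ u v, s(u, v) ∈ M ↔ v = m u := by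
  have hex : ∀ v, ∃ w, s(v, w) ∈ M := fun v => by
    obtain ⟨e, ⟨heM, w, rfl⟩, -⟩ := hM.2 v
    exact ⟨w, heM⟩
  choose m hm using hex
  have hiff : ∀ u v, s(u, v) ∈ M ↔ v = m u := fun u v => by
    refine ⟨fun h => Sym2.congr_right (a := u).1 ?_, fun h => h ▸ hm u⟩
    exact (hM.2 u).unique ⟨h, Sym2.mem_mk_left _ _⟩ ⟨hm u, Sym2.mem_mk_left _ _⟩
  have hinv : Function.Involutive m := fun v =>
    ((hiff (m v) v).1 (Sym2.eq_swap ▸ hm v)).symm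
  exact ⟨hinv.toPerm, hinv, hiff⟩

/-- In a bipartite graph, every fractional perfect matching other than `𝟙_M` gives a perfect
matching other than `M` that contains every edge of `M` on which it is at least `1`. -/
lemma IsPM.exists_isPM_ne {G : SimpleGraph V} [DecidableRel G.Adj] (hG : G.Colorable 2)
    {M : Finset (Sym2 V)} (hM : IsPM G M) {γ : Sym2 V → ℝ} (hγ : IsFPM G γ)
    (hne : γ ≠ charF M) :
    ∃ M', IsPM G M' ∧ M' ≠ M ∧ ∀ e ∈ M, 1 ≤ γ e → e ∈ M' := by
  obtain ⟨c⟩ := hG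
  obtain ⟨m, hinv, hm⟩ := hM.exists_partner
  have hsum : ∀ u, ∑ w, γ s(u, w) = 1 := fun u => vertexSum_eq_sum hγ.2.1 u ▸ hγ.2.2 u
  let B : Matrix V V ℝ := Matrix.of fun u v => γ s(u, m v)
  have hrow : ∀ u, ∑ v, B u v = 1 := fun u =>
    (Equiv.sum_comp m fun w => γ s(u, w)).trans (hsum u)
  have hB : B ∈ doublyStochastic ℝ V := by
    refine mem_doublyStochastic_iff_sum.2 ⟨fun u v => hγ.1 _, hrow, fun v => ?_⟩
    simp only [B, Matrix.of_apply, Sym2.eq_swap (b := m v)]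
    exact hsum (m v)
  obtain ⟨w, hw₀, hw₁, hwB⟩ := exists_eq_sum_perm_of_mem_doublyStochastic hB
  obtain ⟨σ, hσ₀, hσ₁⟩ : ∃ σ, 0 < w σ ∧ σ ≠ 1 := by
    by_contra! h
    have hw : ∀ σ, σ ≠ 1 → w σ = 0 := fun σ hσ =>
      le_antisymm (not_lt.1 fun h' => hσ (h σ h')) (hw₀ σ)
    have hone : w 1 = 1 := by
      rw [← hw₁, Finset.sum_eq_single 1 (fun σ _ hσ => hw σ hσ) (by simp)]
    have hB₁ : B = 1 := by
      rw [← hwB, Finset.sum_eq_single 1 (fun σ _ hσ => by rw [hw σ hσ, zero_smul]) (by simp),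
        hone, one_smul, Matrix.permMatrix_one]
    refine hne (funext fun e => ?_)
    induction e with | _ u v
    have : γ s(u, v) = B u (m v) := by simp [B, hinv]
    rw [this, hB₁, Matrix.one_apply, charF]
    refine if_congr ?_ rfl rfl
    rw [Sym2.eq_swap, hm]
  have hpos : ∀ u, 0 < B u (σ u) := fun u => by
    rw [← hwB, Matrix.sum_apply]
    refine Finset.sum_pos' (fun τ _ => ?_) ⟨σ, Finset.mem_univ _, ?_⟩
    · have := hw₀ τ
      simp only [Matrix.smul_apply, Equiv.Perm.permMatrix, PEquiv.toMatrix_apply, smul_eq_mul]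
      positivity
    · simpa [Equiv.Perm.permMatrix, PEquiv.toMatrix_apply] using hσ₀
  have hadj : ∀ u, G.Adj u (m (σ u)) := fun u => by
    by_contra h
    exact (hpos u).ne' (hγ.2.1 _ h)
  have hcol : ∀ u v, G.Adj u v → ∀ i, c v = i ↔ c u ≠ i := fun u v h i => by
    have := c.valid h
    omega
  obtain ⟨u₀, hu₀⟩ : ∃ u, σ u ≠ u := by
    by_contra! h
    exact hσ₁ (Equiv.ext h)
  have hfix : ∀ u, 1 ≤ γ s(u, m u) → σ u = u := fun u hu => by
    by_contra h
    have h₁ : ∑ v ∈ {u, σ u}, B u v ≤ ∑ v, B u v :=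
      Finset.sum_le_sum_of_subset_of_nonneg (Finset.subset_univ _) fun v _ _ => hγ.1 _
    rw [hrow, Finset.sum_pair (Ne.symm h)] at h₁
    have h₂ : 1 ≤ B u u := hu
    linarith [hpos u]
  let M' : Finset (Sym2 V) := (univ.filter fun u => c u = c u₀).image fun u => s(u, m (σ u))
  have hM' : ∀ u, c u = c u₀ → s(u, m (σ u)) ∈ M' := fun u hu =>
    Finset.mem_image_of_mem _ (by simpa using hu)
  have hmem : ∀ e ∈ M', ∃ u, c u = c u₀ ∧ s(u, m (σ u)) = e := fun e he => by
    simpa [M'] using he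
  refine ⟨M', ⟨fun e he => ?_, fun v => ?_⟩, fun h => ?_, fun e he h₁ => ?_⟩
  · obtain ⟨u, -, rfl⟩ := hmem e he
    exact hadj u
  · have hcσ : ∀ u, c u = c u₀ → c (m (σ u)) ≠ c u₀ := fun u hu h =>
      (hcol _ _ (hadj u) _).1 h hu
    by_cases hv : c v = c u₀
    · refine ⟨_, ⟨hM' v hv, Sym2.mem_mk_left _ _⟩, ?_⟩
      rintro e ⟨he, hve⟩
      obtain ⟨u, hu, rfl⟩ := hmem e he
      rcases Sym2.mem_iff.1 hve with rfl | rfl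
      · rfl
      · exact absurd hv (hcσ u hu)
    · have hmσ : m (σ (σ⁻¹ (m v))) = v := by simp [hinv]
      have hu : c (σ⁻¹ (m v)) = c u₀ := by
        by_contra hu
        have := (hcol _ _ (hadj (σ⁻¹ (m v))) (c u₀)).2 hu
        rw [hmσ] at this
        exact hv this
      refine ⟨_, ⟨hM' _ hu, by simp [hinv]⟩, ?_⟩
      rintro e ⟨he, hve⟩
      obtain ⟨u, hu, rfl⟩ := hmem e he
      rcases Sym2.mem_iff.1 hve with rfl | rfl
      · exact absurd hu hv
      · simp [hinv]
  · have := hM' u₀ rfl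
    rw [h, hm] at this
    exact hu₀ (m.injective this)
  · have key : ∀ u, c u = c u₀ → 1 ≤ γ s(u, m u) → s(u, m u) ∈ M' := fun u hu hle => by
      have := hM' u hu
      rwa [hfix u hle] at this
    induction e with | _ u v
    obtain rfl := (hm u v).1 he
    by_cases hu : c u = c u₀
    · exact key u hu h₁
    · have hcm : c (m u) = c u₀ := (hcol u (m u) (hM.1 he) _).2 hu
      have := key (m u) hcm
      rw [hinv, Sym2.eq_swap] at this
      exact this h₁

/-- In a bipartite graph, the characteristic function of a forcing set is a forcing function. -/
lemma IsForcingSet.isForcing_charF {G : SimpleGraph V} [DecidableRel G.Adj]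
    (hG : G.Colorable 2) {M S : Finset (Sym2 V)} (hM : IsPM G M) (hS : IsForcingSet G ↑S M) :
    IsForcing G (charF S) (charF M) := by
  have hSM : S ⊆ M := Finset.coe_subset.1 hS.1
  refine ⟨fun e => ?_, fun e he => if_neg fun h => he (hM.1 (hSM h)), charF_mono hSM,
    fun γ hγ hle => ?_⟩
  · unfold charF
    split_ifs <;> norm_num
  · by_contra hne
    obtain ⟨M', hM', hne', hsub⟩ := hM.exists_isPM_ne hG hγ hne
    refine hne' (hS.2 M' hM' fun e he => hsub e (hSM he) ?_)
    have := hle e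
    rwa [charF, if_pos (Finset.mem_coe.1 he)] at this

/-- For a perfect matching `M` one has `f_f(G,𝟙_M) ≥ f(G,M)`; moreover if `G` is
bipartite then `f_f(G,𝟙_M) = f(G,M)`. -/
theorem ffN_ge_fN (G : SimpleGraph V) [DecidableRel G.Adj]
    (M : Finset (Sym2 V)) (hM : IsPM G M) :
    (fN G M : ℝ) ≤ ffN G (charF M) ∧
      (G.Colorable 2 → ffN G (charF M) = (fN G M : ℝ)) := by
  have hlb : (fN G M : ℝ) ≤ ffN G (charF M) := by
    refine le_csInf ⟨_, _, hM.isForcing_charF, rfl⟩ ?_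
    rintro _ ⟨α, hα, rfl⟩
    exact fN_le_eSum hM hα
  refine ⟨hlb, fun hG => le_antisymm ?_ hlb⟩
  have hne : {n : ℕ | ∃ S : Finset (Sym2 V), IsForcingSet G ↑S M ∧ S.card = n}.Nonempty :=
    ⟨_, _, hM.isForcing_charF.isForcingSet hM, rfl⟩
  obtain ⟨S, hS, hcard⟩ := Nat.sInf_mem hne
  have hbdd : BddBelow {x : ℝ | ∃ α, IsForcing G α (charF M) ∧ x = eSum G α} := by
    refine ⟨fN G M, ?_⟩
    rintro _ ⟨α, hα, rfl⟩
    exact fN_le_eSum hM hα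
  calc ffN G (charF M) ≤ eSum G (charF S) := csInf_le hbdd ⟨_, hS.isForcing_charF hG hM, rfl⟩
    _ = S.card := eSum_charF (hS.1.trans hM.1)
    _ = fN G M := by rw [hcard, fN]
end

section
/- Let G be a finite simple graph. The function f_f : P_f(G) → ℝ, γ ↦ f_f(G,γ), is continuous on the fractional perfect matching polytope P_f(G) with respect to the metric d(γ₁,γ₂) = Σ_{e∈E(G)} |γ₁(e) − γ₂(e)|; i.e., for every γ₁ ∈ P_f(G) and every ε > 0 there exists δ > 0 such that for every γ₂ ∈ P_f(G) with d(γ₁,γ₂) < δ one has |f_f(G,γ₁) − f_f(G,γ₂)| < ε. -/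
open Finset

variable {V : Type} [Fintype V] [DecidableEq V]

/-- A fractional perfect matching that dominates another one is equal to it. -/
theorem IsFPM.isForcing_self {G : SimpleGraph V} [DecidableRel G.Adj] {γ : Sym2 V → ℝ}
    (hγ : IsFPM G γ) : IsForcing G γ γ := by
  refine ⟨hγ.1, hγ.2.1, le_rfl, fun γ' hγ' hle => funext fun e => ?_⟩
  by_cases he : e ∈ G.edgeSet
  · obtain ⟨v, hv⟩ : ∃ v, v ∈ e := ⟨_, Sym2.out_fst_mem e⟩
    have hsum : vertexSum G γ v = vertexSum G γ' v := by rw [hγ.2.2 v, hγ'.2.2 v]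
    have hterm := (Finset.sum_eq_sum_iff_of_le (s := G.edgeFinset)
      (f := fun e => if v ∈ e then γ e else 0) (g := fun e => if v ∈ e then γ' e else 0)
      (fun i _ => by
        have := hle i
        split_ifs <;> simp [this])).1 hsum e (by simpa using he)
    simpa [hv] using hterm.symm
  · rw [hγ.2.1 e he, hγ'.2.1 e he]

theorem vertexSum_add_mul_sub (G : SimpleGraph V) [DecidableRel G.Adj]
    (γ₁ γ' γ₂ : Sym2 V → ℝ) (t : ℝ) (v : V) :
    vertexSum G (fun e => γ₁ e + t * (γ' e - γ₂ e)) v =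
      vertexSum G γ₁ v + t * (vertexSum G γ' v - vertexSum G γ₂ v) := by
  simp only [vertexSum, ← Finset.sum_sub_distrib, Finset.mul_sum, ← Finset.sum_add_distrib]
  refine Finset.sum_congr rfl fun e _ => ?_
  split_ifs <;> simp

/-- Whether `α` forces `γ` depends only on the set of edges where `α` and `γ` agree: restricting
any other fractional perfect matching `γ₂` to this set yields a forcing function for `γ₂`. -/
theorem IsForcing.transfer {G : SimpleGraph V} [DecidableRel G.Adj] {α γ₁ γ₂ : Sym2 V → ℝ}
    (hα : IsForcing G α γ₁) (hγ₁ : IsFPM G γ₁) (hγ₂ : IsFPM G γ₂) :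
    IsForcing G (fun e => if α e < γ₁ e then 0 else γ₂ e) γ₂ := by
  refine ⟨fun e => ?_, fun e he => ?_, fun e => ?_, fun γ' hγ' hle => ?_⟩
  · dsimp only
    split_ifs
    exacts [le_rfl, hγ₂.1 e]
  · simp [hγ₂.2.1 e he]
  · dsimp only
    split_ifs
    exacts [hγ₂.1 e, le_rfl]
  · have hev : ∀ᶠ t : ℝ in nhdsWithin 0 (Set.Ioi 0),
        ∀ e, α e ≤ γ₁ e + t * (γ' e - γ₂ e) := by
      rw [Filter.eventually_all]
      intro e
      by_cases h : α e < γ₁ e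
      · have hcont : Filter.Tendsto (fun t : ℝ => γ₁ e + t * (γ' e - γ₂ e)) (nhds 0)
            (nhds (γ₁ e)) := by
          have : Continuous fun t : ℝ => γ₁ e + t * (γ' e - γ₂ e) := by fun_prop
          simpa using this.tendsto 0
        exact ((hcont.eventually (lt_mem_nhds h)).filter_mono nhdsWithin_le_nhds).mono
          fun t ht => ht.le
      · filter_upwards [self_mem_nhdsWithin] with t ht
        have hle' := hle e
        simp only [h, if_false] at hle'
        have hmul := mul_nonneg (le_of_lt (Set.mem_Ioi.1 ht)) (sub_nonneg.2 hle')
        have := hα.2.2.1 e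
        linarith
    obtain ⟨t, ht, ht0⟩ := (hev.and self_mem_nhdsWithin).exists
    have ht0 : (0 : ℝ) < t := ht0
    have heq := hα.2.2.2 (fun e => γ₁ e + t * (γ' e - γ₂ e))
      ⟨fun e => (hα.1 e).trans (ht e),
        fun e he => by simp [hγ₁.2.1 e he, hγ₂.2.1 e he, hγ'.2.1 e he],
        fun v => by
          rw [vertexSum_add_mul_sub, hγ₁.2.2, hγ₂.2.2, hγ'.2.2]
          simp⟩ ht
    funext e
    have he := congrFun heq e
    have hmul : t * (γ' e - γ₂ e) = 0 := by simpa using he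
    exact sub_eq_zero.1 ((mul_eq_zero.1 hmul).resolve_left ht0.ne')

theorem ffN_le_add_sum_abs_sub {G : SimpleGraph V} [DecidableRel G.Adj] {γ₁ γ₂ : Sym2 V → ℝ}
    (hγ₁ : IsFPM G γ₁) (hγ₂ : IsFPM G γ₂) :
    ffN G γ₂ ≤ ffN G γ₁ + ∑ e ∈ G.edgeFinset, |γ₁ e - γ₂ e| := by
  rw [← sub_le_iff_le_add]
  refine le_csInf ⟨_, γ₁, hγ₁.isForcing_self, rfl⟩ ?_
  rintro x ⟨α, hα, rfl⟩
  rw [sub_le_iff_le_add]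
  have hbdd : BddBelow {x : ℝ | ∃ α, IsForcing G α γ₂ ∧ x = eSum G α} := by
    refine ⟨0, ?_⟩
    rintro x ⟨β, hβ, rfl⟩
    exact Finset.sum_nonneg fun e _ => hβ.1 e
  refine (csInf_le hbdd ⟨_, hα.transfer hγ₁ hγ₂, rfl⟩).trans ?_
  rw [eSum, eSum, ← Finset.sum_add_distrib]
  refine Finset.sum_le_sum fun e _ => ?_
  split_ifs with h
  · exact add_nonneg (hα.1 e) (abs_nonneg _)
  · have := neg_abs_le (γ₁ e - γ₂ e)
    linarith [not_lt.1 h]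

/-- The fractional forcing number `γ ↦ f_f(G,γ)` is continuous on the fractional perfect
matching polytope `P_f(G)` with respect to the metric `d(γ₁,γ₂) = Σ_e |γ₁ e - γ₂ e|`. -/
theorem ffN_continuous (G : SimpleGraph V) [DecidableRel G.Adj]
    (γ₁ : Sym2 V → ℝ) (hγ₁ : IsFPM G γ₁) (ε : ℝ) (hε : 0 < ε) :
    ∃ δ > 0, ∀ γ₂, IsFPM G γ₂ → ∑ e ∈ G.edgeFinset, |γ₁ e - γ₂ e| < δ →
      |ffN G γ₁ - ffN G γ₂| < ε := by
  refine ⟨ε, hε, fun γ₂ hγ₂ hd => ?_⟩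
  have h₁ := ffN_le_add_sum_abs_sub hγ₁ hγ₂
  have h₂ := ffN_le_add_sum_abs_sub hγ₂ hγ₁
  simp only [abs_sub_comm (γ₂ _)] at h₂
  rw [abs_lt]
  constructor <;> linarith
end
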